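/- arXiv:0710.3647 — 2 statements merged into one kernel-verified Lean document; each statement's English description precedes it below -/
import Mathlib

section
/- Let α > 0, let X have the gamma distribution with shape α and scale 1, let W = log X (i.e., the law of W is the pushforward under log of the gamma distribution), and let Z be the normal distribution with mean log α and variance 1/α. Then D(Z‖law(W)) = log Γ(α) − (1/2) log(2π) + (1/2) log α + α·e^{1/(2α)} − α·log α − 1/2, and for every α ≥ 1/2 this quantity is at most 1/(3α). -/
open MeasureTheory ProbabilityTheory Real
open scoped NNReal

/-- The gamma distribution with shape `α` and scale `β`: the measure on `ℝ` with density
`x ^ (α - 1) * exp (-x / β) / (Γ α * β ^ α)` on `(0, ∞)`. -/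
noncomputable def gammaDist (α β : ℝ) : Measure ℝ :=
  volume.withDensity fun x =>
    ENNReal.ofReal (if x ∈ Set.Ioi (0 : ℝ) then
      x ^ (α - 1) * Real.exp (-x / β) / (Real.Gamma α * β ^ α) else 0)

/-- Kullback–Leibler divergence `D(P‖Q) = ∫ log (dP/dQ) dP`. -/
noncomputable def klDiv (P Q : Measure ℝ) : ℝ :=
  ∫ x, Real.log (P.rnDeriv Q x).toReal ∂P


lemma aux_log_step (y : ℝ) (hy : 0 < y) :
    (y + 1 / 2) * (Real.log (y + 1) - Real.log y) - 1 ≤ 1 / (12 * y) - 1 / (12 * (y + 1)) := by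
  have h := Real.hasSum_log_one_add_inv hy
  have e : Real.log (1 + y⁻¹) = Real.log (y + 1) - Real.log y := by
    rw [← Real.log_div (by positivity) hy.ne']
    congr 1
    field_simp
  rw [e] at h
  set u : ℝ := 1 / (2 * y + 1) with hu
  have hu0 : 0 < u := by positivity
  have hu1 : u < 1 := by rw [hu, div_lt_one (by positivity)]; linarith
  have hu2 : u ^ 2 < 1 := by nlinarith
  have h2 := h.mul_left (y + 1 / 2)
  have h3 := (hasSum_nat_add_iff' 1).mpr h2
  have g := (hasSum_geometric_of_lt_one (sq_nonneg u) hu2).mul_left (u ^ 2 / 3)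
  have hyu : (y + 1 / 2) * 2 * u = 1 := by rw [hu]; field_simp
  have hle := hasSum_le (fun k => ?_) h3 g
  · have e1 : u ^ 2 / 3 * (1 - u ^ 2)⁻¹ = 1 / (12 * y) - 1 / (12 * (y + 1)) := by
      have : 1 - u ^ 2 = 4 * y * (y + 1) * u ^ 2 := by
        rw [hu]; field_simp; ring
      rw [this]
      field_simp
      ring
    rw [e1] at hle
    have e2 : ∑ i ∈ Finset.range 1, (y + 1 / 2) * (2 * (1 / (2 * (i : ℝ) + 1)) * u ^ (2 * i + 1)) = 1 := by
      simp
      linarith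
    rw [e2] at hle
    exact hle
  · have : (y + 1 / 2) * (2 * (1 / (2 * ((k + 1 : ℕ) : ℝ) + 1)) * u ^ (2 * (k + 1) + 1))
        = (1 / (2 * (k : ℝ) + 3)) * (u ^ 2 * (u ^ 2) ^ k) := by
      calc _ = ((y + 1 / 2) * 2 * u) * ((1 / (2 * ((k + 1 : ℕ) : ℝ) + 1)) * (u ^ 2 * (u ^ 2) ^ k)) := by
            ring
        _ = _ := by
            rw [hyu]
            push_cast
            ring
    rw [this]
    have h4 : (1 / (2 * (k : ℝ) + 3)) ≤ 1 / 3 := by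
      apply one_div_le_one_div_of_le <;> linarith [Nat.cast_nonneg (α := ℝ) k]
    calc _ ≤ (1 / 3 : ℝ) * (u ^ 2 * (u ^ 2) ^ k) := by gcongr
      _ = _ := by ring

lemma aux_sum (x : ℝ) (hx : 0 < x) (n : ℕ) :
    ((x + n) - 1 / 2) * Real.log (x + n) - (x + n) + 1 / (12 * (x + n))
      - ((x - 1 / 2) * Real.log x - x + 1 / (12 * x)) ≤ ∑ m ∈ Finset.range n, Real.log (x + m) := by
  induction n with
  | zero => simp
  | succ n ih =>
    rw [Finset.sum_range_succ]
    have h := aux_log_step (x + n) (by positivity)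
    push_cast
    rw [← add_assoc]
    linarith

open Filter Topology in
lemma aux_stirling (x : ℝ) (hx : 0 < x) :
    Real.log (Real.Gamma x) ≤
      (x - 1 / 2) * Real.log x - x + 1 / (12 * x) + 1 / 2 * Real.log (2 * π) := by
  have h1 := Real.BohrMollerup.tendsto_log_gamma hx
  have h2 : Tendsto (fun n : ℕ => Real.log (Stirling.stirlingSeq n)) atTop (𝓝 (Real.log √π)) :=
    (Stirling.tendsto_stirlingSeq_sqrt_pi).log (by positivity)
  have h3 : Tendsto (fun n : ℕ => (n : ℝ) * Real.log (1 + (x + 1) / n)) atTop (𝓝 (x + 1)) :=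
    (Real.tendsto_mul_log_one_add_div_atTop (x + 1)).comp tendsto_natCast_atTop_atTop
  have h4 := ((h2.add_const (1 / 2 * Real.log 2)).add_const
    ((x - 1 / 2) * Real.log x - x + 1 / (12 * x))).add (h3.const_sub (x + 1))
  have h5 := le_of_tendsto_of_tendsto h1 h4 ?_
  · rw [Real.log_sqrt (by positivity)] at h5
    rw [Real.log_mul (by norm_num) (by positivity)]
    linarith
  · filter_upwards [eventually_ge_atTop 1] with n hn
    have hn' : (0 : ℝ) < n := by exact_mod_cast hn
    have hs := aux_sum x hx (n + 1)
    rw [Stirling.log_stirlingSeq_formula, Real.log_mul (by norm_num) hn'.ne',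
      Real.log_div hn'.ne' (Real.exp_pos _).ne', Real.log_exp]
    unfold Real.BohrMollerup.logGammaSeq
    have hl : Real.log (1 + (x + 1) / n) = Real.log (x + (n + 1)) - Real.log n := by
      rw [← Real.log_div (by positivity) hn'.ne']
      congr 1
      field_simp
      ring
    have hpos : 0 ≤ (x + 1 / 2) * Real.log (1 + (x + 1) / n) := by
      apply mul_nonneg (by positivity)
      apply Real.log_nonneg
      have : 0 ≤ (x + 1) / n := by positivity
      linarith
    have hpos2 : 0 ≤ 1 / (12 * (x + ((n : ℝ) + 1))) := by positivity
    push_cast at hs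
    rw [hl] at hpos ⊢
    linarith

lemma aux_bound (α : ℝ) (hα : 1 / 2 ≤ α) :
    Real.log (Real.Gamma α) - (1 / 2) * Real.log (2 * π) + (1 / 2) * Real.log α
        + α * Real.exp (1 / (2 * α)) - α * Real.log α - 1 / 2 ≤ 1 / (3 * α) := by
  have h0 : 0 < α := by linarith
  have h := aux_stirling α h0
  have ht0 : 0 < 1 / (2 * α) := by positivity
  have ht : |1 / (2 * α)| ≤ 1 := by
    rw [abs_of_pos ht0, div_le_one (by positivity)]; linarith
  have he := (abs_le.mp (Real.abs_exp_sub_one_sub_id_le ht)).2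
  have he2 := mul_le_mul_of_nonneg_left he h0.le
  have e1 : α * (1 / (2 * α)) ^ 2 = 1 / (4 * α) := by field_simp; norm_num
  have e2 : α * (1 / (2 * α)) = 1 / 2 := by field_simp
  have e3 : 1 / (4 * α) + 1 / (12 * α) = 1 / (3 * α) := by field_simp; norm_num
  rw [e1, mul_sub, mul_sub, e2] at he2
  linarith

noncomputable def lgDens (α : ℝ) (w : ℝ) : ℝ := Real.exp (α * w - Real.exp w) / Real.Gamma α

lemma lgDens_pos (α : ℝ) (hα : 0 < α) (w : ℝ) : 0 < lgDens α w :=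
  div_pos (Real.exp_pos _) (Real.Gamma_pos_of_pos hα)

lemma measurable_lgDens (α : ℝ) : Measurable (lgDens α) := by
  unfold lgDens; fun_prop

lemma map_log_gammaDist (α : ℝ) :
    (gammaDist α 1).map Real.log = volume.withDensity fun w => ENNReal.ofReal (lgDens α w) := by
  ext s hs
  rw [Measure.map_apply Real.measurable_log hs, withDensity_apply _ hs, gammaDist,
    withDensity_apply _ (Real.measurable_log hs)]
  have e : (fun x : ℝ => ENNReal.ofReal (if x ∈ Set.Ioi (0 : ℝ) then
      x ^ (α - 1) * Real.exp (-x / 1) / (Real.Gamma α * 1 ^ α) else 0)) =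
      (Set.Ioi (0 : ℝ)).indicator (fun x => ENNReal.ofReal
        (x ^ (α - 1) * Real.exp (-x / 1) / (Real.Gamma α * 1 ^ α))) := by
    ext x
    by_cases hx : x ∈ Set.Ioi (0 : ℝ) <;> simp [hx, Set.indicator]
  rw [e, setLIntegral_indicator measurableSet_Ioi]
  have e2 : Set.Ioi (0 : ℝ) ∩ Real.log ⁻¹' s = Real.exp '' s := by
    ext x
    constructor
    · rintro ⟨h1, h2⟩
      exact ⟨Real.log x, h2, Real.exp_log h1⟩
    · rintro ⟨w, hw, rfl⟩
      exact ⟨Real.exp_pos w, by simpa using hw⟩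
  rw [e2, lintegral_image_eq_lintegral_abs_deriv_mul hs
    (fun x _ => (Real.hasDerivAt_exp x).hasDerivWithinAt) (Real.exp_injective.injOn)]
  refine lintegral_congr fun w => ?_
  rw [abs_of_pos (Real.exp_pos w), ← ENNReal.ofReal_mul (Real.exp_pos w).le]
  congr 1
  rw [lgDens, Real.one_rpow, mul_one, div_one, ← Real.exp_mul, mul_div_assoc', ← Real.exp_add,
    ← Real.exp_add]
  congr 2
  ring

lemma klDiv_formula (α : ℝ) (hα : 0 < α) :
    klDiv (gaussianReal (Real.log α) (Real.toNNReal (1 / α)))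
        ((gammaDist α 1).map Real.log) =
      Real.log (Real.Gamma α) - (1 / 2) * Real.log (2 * π) + (1 / 2) * Real.log α
        + α * Real.exp (1 / (2 * α)) - α * Real.log α - 1 / 2 := by
  set μ := Real.log α with hμ
  set v := Real.toNNReal (1 / α) with hv
  have hvr : (v : ℝ) = 1 / α := Real.coe_toNNReal _ (by positivity)
  have hv0 : v ≠ 0 := by
    intro h
    rw [h] at hvr
    have : 0 < 1 / α := by positivity
    simp at hvr
    exact hα.ne hvr
  rw [map_log_gammaDist]
  set Q := volume.withDensity fun w => ENNReal.ofReal (lgDens α w) with hQ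
  have hqm : Measurable fun w => ENNReal.ofReal (lgDens α w) :=
    (measurable_lgDens α).ennreal_ofReal
  have hrm : Measurable fun w => ENNReal.ofReal (gaussianPDFReal μ v w / lgDens α w) :=
    ((measurable_gaussianPDFReal μ v).div (measurable_lgDens α)).ennreal_ofReal
  have hP : gaussianReal μ v =
      Q.withDensity fun w => ENNReal.ofReal (gaussianPDFReal μ v w / lgDens α w) := by
    rw [hQ, ← withDensity_mul _ hqm hrm, gaussianReal_of_var_ne_zero _ hv0]
    congr 1
    ext w
    rw [Pi.mul_apply, ← ENNReal.ofReal_mul (lgDens_pos α hα w).le, gaussianPDF,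
      mul_div_cancel₀ _ (lgDens_pos α hα w).ne']
  have : SigmaFinite Q := by rw [hQ]; infer_instance
  have hac : gaussianReal μ v ≪ Q := by rw [hP]; exact withDensity_absolutelyContinuous _ _
  have hrn : (gaussianReal μ v).rnDeriv Q =ᵐ[gaussianReal μ v]
      fun w => ENNReal.ofReal (gaussianPDFReal μ v w / lgDens α w) := by
    apply hac.ae_le
    nth_rw 1 [hP]
    exact Measure.rnDeriv_withDensity Q hrm
  have hlog : ∀ w, Real.log (gaussianPDFReal μ v w / lgDens α w) =
      (Real.log (Real.Gamma α) - (1 / 2) * Real.log (2 * π) + (1 / 2) * Real.log α)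
       - α / 2 * (w - μ) ^ 2 - α * w + Real.exp (1 * w) := by
    intro w
    rw [Real.log_div (gaussianPDFReal_pos _ _ _ hv0).ne' (lgDens_pos α hα w).ne', lgDens,
      Real.log_div (Real.exp_pos _).ne' (Real.Gamma_pos_of_pos hα).ne', Real.log_exp,
      gaussianPDFReal, hvr, Real.log_mul (by positivity) (Real.exp_pos _).ne', Real.log_exp,
      Real.log_inv, Real.log_sqrt (by positivity), Real.log_mul (by positivity) (by positivity),
      one_div, Real.log_inv, one_mul]
    field_simp
    ring
  have hI1 : Integrable (fun w : ℝ => w) (gaussianReal μ v) :=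
    (memLp_id_gaussianReal 1).integrable (by simp)
  have hI2 : Integrable (fun w : ℝ => (w - μ) ^ 2) (gaussianReal μ v) :=
    MemLp.integrable_sq ((memLp_id_gaussianReal 2).sub (memLp_const μ))
  have hI3 : Integrable (fun w : ℝ => Real.exp (1 * w)) (gaussianReal μ v) :=
    integrable_exp_mul_gaussianReal 1
  have hV : ∫ w, (w - μ) ^ 2 ∂(gaussianReal μ v) = 1 / α := by
    have := variance_fun_id_gaussianReal (μ := μ) (v := v)
    rw [variance_eq_integral measurable_id'.aemeasurable, integral_id_gaussianReal, hvr] at this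
    exact this
  have hE : ∫ w, Real.exp (1 * w) ∂(gaussianReal μ v) = α * Real.exp (1 / (2 * α)) := by
    have := congrFun (mgf_fun_id_gaussianReal (μ := μ) (v := v)) 1
    rw [mgf, hvr, Real.exp_add, mul_one, hμ, Real.exp_log hα] at this
    rw [hμ, this]
    congr 2
    field_simp
  unfold klDiv
  rw [integral_congr_ae (g := fun w =>
      (Real.log (Real.Gamma α) - (1 / 2) * Real.log (2 * π) + (1 / 2) * Real.log α)
       - α / 2 * (w - μ) ^ 2 - α * w + Real.exp (1 * w))]
  · set c := Real.log (Real.Gamma α) - (1 / 2) * Real.log (2 * π) + (1 / 2) * Real.log α with hc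
    have j0 : Integrable (fun _ : ℝ => c) (gaussianReal μ v) := integrable_const _
    have j1 : Integrable (fun w : ℝ => α / 2 * (w - μ) ^ 2) (gaussianReal μ v) := hI2.const_mul _
    have j2 : Integrable (fun w : ℝ => α * w) (gaussianReal μ v) := hI1.const_mul _
    have j3 : Integrable (fun w : ℝ => c - α / 2 * (w - μ) ^ 2) (gaussianReal μ v) := j0.sub j1
    have j4 : Integrable (fun w : ℝ => c - α / 2 * (w - μ) ^ 2 - α * w) (gaussianReal μ v) :=
      j3.sub j2
    rw [integral_add j4 hI3, integral_sub j3 j2, integral_sub j0 j1, integral_const_mul,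
      integral_const_mul, hV, hE, integral_id_gaussianReal]
    have e5 : α / 2 * (1 / α) = 1 / 2 := by field_simp
    rw [e5]
    simp only [integral_const, probReal_univ, one_smul]
    rw [hc, hμ]
    ring
  · filter_upwards [hrn] with w hw
    rw [hw, ENNReal.toReal_ofReal
      (div_nonneg (gaussianPDFReal_nonneg _ _ _) (lgDens_pos α hα w).le), hlog]

theorem klDiv_gaussian_logGamma (α : ℝ) (hα : 0 < α) :
    klDiv (gaussianReal (Real.log α) (Real.toNNReal (1 / α)))
        ((gammaDist α 1).map Real.log) =
      Real.log (Real.Gamma α) - (1 / 2) * Real.log (2 * π) + (1 / 2) * Real.log α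
        + α * Real.exp (1 / (2 * α)) - α * Real.log α - 1 / 2 ∧
    (1 / 2 ≤ α →
      klDiv (gaussianReal (Real.log α) (Real.toNNReal (1 / α)))
          ((gammaDist α 1).map Real.log) ≤ 1 / (3 * α)) := by
  exact ⟨klDiv_formula α hα, fun h => (klDiv_formula α hα).le.trans (aux_bound α h)⟩
end

section
/- Let n ≥ 1 be a natural number and σ² > 0. Let V have the gamma distribution with shape n/2 and scale 2σ²/n, and let Z be the normal distribution with mean log σ² and variance 2/n. Then D(Z‖law(log V)) ≤ 1/n, where law(log V) is the pushforward under log of the gamma distribution of V. -/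
open MeasureTheory ProbabilityTheory Real
open scoped NNReal

lemma aux_step (a : ℝ) (ha : 0 < a) :
    (a + 1/2) * Real.log (1 + 1/a) - 1 ≤ 1/(4*a) - 1/(4*(a+1)) := by
  set s := Real.sqrt (a*(a+1)) with hs
  have hp : 0 < a*(a+1) := by positivity
  have hs0 : 0 < s := Real.sqrt_pos.2 hp
  have hs2 : s^2 = a*(a+1) := Real.sq_sqrt hp.le
  have hy : s/a * (s/a) = 1 + 1/a := by
    field_simp; nlinarith
  have hsa : a ≤ s := by
    apply Real.le_sqrt_of_sq_le; nlinarith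
  have hy1 : 1 ≤ s/a := by rw [le_div_iff₀ ha]; linarith
  have h1 : Real.log (s/a) ≤ (s/a - (s/a)⁻¹)/2 := by
    rw [← Real.sinh_log (by positivity)]
    exact Real.self_le_sinh_iff.2 (Real.log_nonneg hy1)
  have h2 : (s/a - (s/a)⁻¹)/2 = 1/(2*s) := by
    field_simp; nlinarith
  have h3 : Real.log (1+1/a) ≤ 1/s := by
    rw [← hy, Real.log_mul (by positivity) (by positivity)]
    rw [h2] at h1
    have : 1/s = 1/(2*s) + 1/(2*s) := by field_simp; norm_num
    linarith
  have h4 : (a+1/2) ≤ s * (1 + 1/(8*s^2)) := by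
    refine (sq_le_sq₀ (by positivity) (by positivity)).1 ?_
    · have : (s * (1 + 1/(8*s^2)))^2 = s^2 + 1/4 + 1/(64*s^2) := by field_simp; ring
      rw [this]
      have : 0 < 1/(64*s^2) := by positivity
      nlinarith
  have h5 : 1/(4*a) - 1/(4*(a+1)) = 1/(4*s^2) := by
    rw [hs2]; field_simp; ring
  rw [h5]
  have h6 : (a+1/2) * Real.log (1+1/a) ≤ (s * (1 + 1/(8*s^2))) * (1/s) := by
    apply mul_le_mul h4 h3 (Real.log_nonneg (by rw [le_add_iff_nonneg_right]; positivity)) (by positivity)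
  have h7 : (s * (1 + 1/(8*s^2))) * (1/s) = 1 + 1/(8*s^2) := by field_simp
  have h8 : 1/(8*s^2) ≤ 1/(4*s^2) := by
    apply one_div_le_one_div_of_le <;> nlinarith
  linarith

noncomputable def muF (x : ℝ) : ℝ :=
  Real.log (Real.Gamma x) - (x - 1/2) * Real.log x + x - 1/2 * Real.log (2 * π)

lemma log_Gamma_add_one {y : ℝ} (hy : 0 < y) :
    Real.log (Real.Gamma (y+1)) = Real.log (Real.Gamma y) + Real.log y := by
  rw [Real.Gamma_add_one hy.ne', Real.log_mul hy.ne' (Real.Gamma_pos_of_pos hy).ne', add_comm]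

lemma muF_step {a : ℝ} (ha : 0 < a) : muF a - 1/(4*a) ≤ muF (a+1) - 1/(4*(a+1)) := by
  have h := aux_step a ha
  have e : (1 + 1/a) = (a+1)/a := by field_simp
  rw [e, Real.log_div (by positivity) ha.ne'] at h
  unfold muF
  rw [log_Gamma_add_one ha]
  nlinarith

lemma muF_tendsto {x : ℝ} (hx : 0 < x) :
    Filter.Tendsto (fun n : ℕ => muF (x + ((n+1 : ℕ) : ℝ))) Filter.atTop (nhds 0) := by
  have h1 := Real.BohrMollerup.tendsto_log_gamma hx
  have h2 : Filter.Tendsto (fun n => Real.log (Stirling.stirlingSeq n)) Filter.atTop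
      (nhds (Real.log (√π))) :=
    Stirling.tendsto_stirlingSeq_sqrt_pi.log (by positivity)
  have h3 : Filter.Tendsto (fun n : ℕ => (n:ℝ) * Real.log (1 + (x+1)/n)) Filter.atTop
      (nhds (x+1)) :=
    (Real.tendsto_mul_log_one_add_div_atTop (x+1)).comp tendsto_natCast_atTop_atTop
  have h4 : Filter.Tendsto (fun n : ℕ => Real.log (1 + (x+1)/n)) Filter.atTop (nhds 0) := by
    have : Filter.Tendsto (fun n : ℕ => 1 + (x+1)/(n:ℝ)) Filter.atTop (nhds (1 + 0)) :=
      tendsto_const_nhds.add (tendsto_const_div_atTop_nhds_zero_nat (x+1))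
    simpa using this.log (by norm_num)
  have h := ((((h1.const_sub (Real.log (Real.Gamma x))).add
    (h2.sub_const (Real.log (√π)))).add_const (x+1)).sub h3).sub (h4.const_mul (x+1/2))
  have e0 : Real.log (Real.Gamma x) - Real.log (Real.Gamma x)
    + (Real.log (√π) - Real.log (√π)) + (x+1) - (x+1) - (x+1/2)*0 = 0 := by ring
  rw [e0] at h
  refine h.congr' ?_
  filter_upwards [Filter.eventually_gt_atTop 0] with n hn
  have hn' : (0:ℝ) < n := by exact_mod_cast hn
  have f := Real.BohrMollerup.f_add_nat_eq (f := fun y => Real.log (Real.Gamma y))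
    (fun {y} hy => log_Gamma_add_one hy) hx (n+1)
  have e : (1 + (x+1)/n) = (x+((n+1:ℕ):ℝ))/n := by push_cast; field_simp; ring
  rw [Stirling.log_stirlingSeq_formula, Real.BohrMollerup.logGammaSeq, muF, f, e,
    Real.log_div (by positivity) hn'.ne', Real.log_div hn'.ne' (by positivity), Real.log_exp,
    Real.log_mul (by norm_num) hn'.ne', Real.log_mul (by norm_num) (by positivity),
    Real.log_sqrt (by positivity)]
  push_cast
  ring

lemma muF_le {a : ℝ} (ha : 0 < a) : muF a ≤ 1/(4*a) := by
  have hmono : Monotone (fun n : ℕ => muF (a+n) - 1/(4*(a+n))) := by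
    apply monotone_nat_of_le_succ
    intro n
    have := muF_step (a := a+n) (by positivity)
    push_cast
    rw [← add_assoc]
    exact this
  have hl : Filter.Tendsto (fun n : ℕ => muF (a + ((n+1 : ℕ) : ℝ))) Filter.atTop (nhds 0) :=
    muF_tendsto ha
  have : muF a - 1/(4*a) ≤ 0 := by
    refine ge_of_tendsto' hl fun n => ?_
    have h := hmono (Nat.zero_le (n+1))
    simp only [Nat.cast_zero, add_zero] at h
    have : 0 ≤ 1/(4*(a+((n+1:ℕ):ℝ))) := by positivity
    linarith
  linarith

noncomputable def qF (a b z : ℝ) : ℝ :=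
  Real.exp (a*z) * Real.exp (-Real.exp z / b) / (Real.Gamma a * b ^ a)

lemma qF_pos {a b : ℝ} (ha : 0 < a) (hb : 0 < b) (z : ℝ) : 0 < qF a b z := by
  have := Real.Gamma_pos_of_pos ha
  unfold qF; positivity

lemma qF_meas (a b : ℝ) : Measurable (qF a b) := by
  unfold qF; fun_prop

lemma map_gamma {a b : ℝ} :
    (gammaDist a b).map Real.log = volume.withDensity (fun z => ENNReal.ofReal (qF a b z)) := by
  ext s hs
  have hm : MeasurableSet (Real.log ⁻¹' s) := Real.measurable_log hs
  rw [Measure.map_apply Real.measurable_log hs, gammaDist, withDensity_apply _ hm,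
    withDensity_apply _ hs]
  have himg : Real.exp '' s = Real.log ⁻¹' s ∩ Set.Ioi 0 := by
    ext x
    constructor
    · rintro ⟨y, hy, rfl⟩
      exact ⟨by simpa using hy, Real.exp_pos y⟩
    · rintro ⟨h1, h2⟩
      exact ⟨Real.log x, h1, Real.exp_log h2⟩
  have h1 : ∫⁻ x in Real.log ⁻¹' s, ENNReal.ofReal (if x ∈ Set.Ioi (0 : ℝ) then
      x ^ (a - 1) * Real.exp (-x / b) / (Real.Gamma a * b ^ a) else 0)
      = ∫⁻ x in Real.exp '' s, ENNReal.ofReal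
        (x ^ (a - 1) * Real.exp (-x / b) / (Real.Gamma a * b ^ a)) := by
    rw [himg, Set.inter_comm, ← Measure.restrict_restrict measurableSet_Ioi,
      ← lintegral_indicator measurableSet_Ioi]
    congr 1
    ext x
    by_cases hx : x ∈ Set.Ioi (0:ℝ) <;> simp [hx, -Set.mem_Ioi]
  rw [h1, lintegral_image_eq_lintegral_abs_deriv_mul hs
    (fun x _ => (Real.hasDerivAt_exp x).hasDerivWithinAt) Real.exp_injective.injOn]
  congr 1
  ext x
  rw [abs_of_pos (Real.exp_pos x), ← ENNReal.ofReal_mul (Real.exp_pos x).le]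
  congr 1
  rw [qF, ← Real.exp_mul, show a * x = x + x*(a-1) by ring, Real.exp_add]
  ring

lemma kl_eq {m : ℝ} {v : ℝ≥0} (hv : v ≠ 0) {a b : ℝ} (ha : 0 < a) (hb : 0 < b) :
    klDiv (gaussianReal m v) ((gammaDist a b).map Real.log) =
      ∫ z, (Real.log (gaussianPDFReal m v z) - Real.log (qF a b z)) ∂(gaussianReal m v) := by
  rw [map_gamma, klDiv]
  set Q := volume.withDensity (fun z => ENNReal.ofReal (qF a b z)) with hQ
  set r : ℝ → ENNReal := fun z => ENNReal.ofReal (gaussianPDFReal m v z / qF a b z) with hr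
  have hrm : Measurable r := by
    have := qF_meas a b
    have := measurable_gaussianPDFReal m v
    fun_prop
  have hP : gaussianReal m v = Q.withDensity r := by
    rw [hQ, ← withDensity_mul _ (qF_meas a b).ennreal_ofReal hrm, gaussianReal_of_var_ne_zero _ hv]
    congr 1
    ext z
    have := qF_pos ha hb z
    simp only [Pi.mul_apply, hr, gaussianPDF]
    rw [← ENNReal.ofReal_mul this.le, mul_div_cancel₀ _ this.ne']
  have hac : gaussianReal m v ≪ Q := by
    rw [hP]; exact withDensity_absolutelyContinuous _ _
  have hrn : (gaussianReal m v).rnDeriv Q =ᵐ[Q] r := by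
    conv_lhs => rw [hP]
    exact Measure.rnDeriv_withDensity Q hrm
  apply integral_congr_ae
  filter_upwards [hac.ae_le hrn] with z hz
  have h1 := qF_pos ha hb z
  have h2 := gaussianPDFReal_pos m v z hv
  rw [hz, hr, ENNReal.toReal_ofReal (by positivity), Real.log_div h2.ne' h1.ne']

lemma kl_val {m : ℝ} {v : ℝ≥0} (hv : v ≠ 0) {a b : ℝ} (ha : 0 < a) (hb : 0 < b) :
    klDiv (gaussianReal m v) ((gammaDist a b).map Real.log) =
      -(1/2) * Real.log (2 * π * v) - 1/2 - a * m + Real.exp (m + v/2) / b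
        + Real.log (Real.Gamma a) + a * Real.log b := by
  rw [kl_eq hv ha hb]
  have hv' : (0:ℝ) < v := by positivity
  have hG := Real.Gamma_pos_of_pos ha
  have h0 : ∀ z, Real.log (gaussianPDFReal m v z) - Real.log (qF a b z) =
      (-(1/2) * Real.log (2 * π * v) + Real.log (Real.Gamma a) + a * Real.log b)
      + (-(1/(2*v)) * (z-m)^2 + (-a * z + (1/b) * Real.exp z)) := by
    intro z
    rw [gaussianPDFReal, qF, Real.log_mul (x := (√(2 * π * v))⁻¹) (by positivity) (by positivity), Real.log_inv,
      Real.log_sqrt (by positivity), Real.log_exp, Real.log_div (by positivity) (by positivity),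
      Real.log_mul (x := Real.exp (a * z)) (by positivity) (by positivity), Real.log_exp, Real.log_exp,
      Real.log_mul hG.ne' (by positivity), Real.log_rpow hb]
    field_simp
    ring
  simp_rw [h0]
  have i1 : Integrable (fun z : ℝ => z) (gaussianReal m v) :=
    (memLp_id_gaussianReal 1).integrable (by simp)
  have i2 : Integrable (fun z : ℝ => (z-m)^2) (gaussianReal m v) := by
    have : MemLp (fun z : ℝ => z - m) 2 (gaussianReal m v) :=
      (memLp_id_gaussianReal (μ := m) (v := v) 2).sub (memLp_const m)
    exact this.integrable_sq
  have i3 : Integrable (fun z : ℝ => Real.exp z) (gaussianReal m v) := by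
    simpa using integrable_exp_mul_gaussianReal (μ := m) (v := v) 1
  have j2 : ∫ z, (z-m)^2 ∂(gaussianReal m v) = v := by
    have := variance_fun_id_gaussianReal (μ := m) (v := v)
    rw [variance_eq_integral aemeasurable_id', integral_id_gaussianReal] at this
    exact this
  have j3 : ∫ z, Real.exp z ∂(gaussianReal m v) = Real.exp (m + v/2) := by
    have := congrFun (mgf_fun_id_gaussianReal (μ := m) (v := v)) 1
    simpa [mgf] using this
  have k1 : Integrable (fun z : ℝ => -a * z + (1/b) * Real.exp z) (gaussianReal m v) :=
    (i1.const_mul _).add (i3.const_mul _)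
  have k2 : Integrable (fun z : ℝ => -(1/(2*(v:ℝ))) * (z-m)^2 + (-a * z + (1/b) * Real.exp z))
    (gaussianReal m v) := (i2.const_mul _).add k1
  rw [integral_add (integrable_const _) k2, integral_add (i2.const_mul _) k1,
    integral_add (i1.const_mul _) (i3.const_mul _), integral_const_mul, integral_const_mul,
    integral_const_mul, j2, j3, integral_id_gaussianReal, integral_const, probReal_univ, one_smul]
  field_simp
  ring

theorem klDiv_gaussian_log_chiSquare (n : ℕ) (hn : 1 ≤ n) (σ2 : ℝ) (hσ2 : 0 < σ2) :
    klDiv (gaussianReal (Real.log σ2) (Real.toNNReal (2 / n)))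
        ((gammaDist ((n : ℝ) / 2) (2 * σ2 / n)).map Real.log) ≤ 1 / n := by
  have hn1 : (1:ℝ) ≤ n := by exact_mod_cast hn
  have hn0 : (0:ℝ) < n := by linarith
  have hv : Real.toNNReal (2 / (n:ℝ)) ≠ 0 := by
    have : 0 < 2 / (n:ℝ) := by positivity
    simpa using this
  rw [kl_val hv (by positivity) (by positivity), Real.coe_toNNReal _ (by positivity)]
  have hmu := muF_le (a := (n:ℝ)/2) (by positivity)
  have hx : |1/(n:ℝ)| ≤ 1 := by
    rw [abs_of_pos (by positivity), div_le_one hn0]; exact hn1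
  have he := (abs_le.1 (Real.abs_exp_sub_one_sub_id_le hx)).2
  rw [muF] at hmu
  have e1 : Real.log (2 * π * (2/(n:ℝ))) = Real.log (2*π) - Real.log ((n:ℝ)/2) := by
    rw [← Real.log_div (by positivity) (by positivity)]
    congr 1; field_simp
  have e2 : Real.log (2*σ2/n) = Real.log σ2 - Real.log ((n:ℝ)/2) := by
    rw [← Real.log_div (by positivity) (by positivity)]
    congr 1; field_simp
  have e3 : Real.exp (Real.log σ2 + 2/(n:ℝ)/2) / (2*σ2/n) = n/2 * Real.exp (1/n) := by
    rw [Real.exp_add, Real.exp_log hσ2, show 2/(n:ℝ)/2 = 1/n by field_simp]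
    field_simp
  rw [e1, e2, e3]
  have h9 : (n:ℝ)/2 * Real.exp (1/n) ≤ n/2 * (1 + 1/n + (1/n)^2) := by
    apply mul_le_mul_of_nonneg_left _ (by positivity); linarith
  have h10 : (n:ℝ)/2 * (1 + 1/n + (1/n)^2) = n/2 + 1/2 + 1/(2*n) := by field_simp
  have h11 : 1/(4*((n:ℝ)/2)) = 1/(2*n) := by field_simp; norm_num
  have h12 : 1/(n:ℝ) = 1/(2*n) + 1/(2*n) := by field_simp; norm_num
  rw [h11] at hmu
  rw [h10] at h9
  nlinarith
end
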